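/- Let M₁ be the two-sided ideal of R generated by 1 − w·w* together with soc(T), and let M₂ be the two-sided ideal of R generated by 1 − w*·w together with soc(T). Then M₁·M₂ = M₁ ∩ M₂ = soc(T), where M₁·M₂ denotes the set of finite sums of products x·y with x ∈ M₁ and y ∈ M₂. -/

import Mathlib

set_option synthInstance.maxHeartbeats 1000000
set_option maxHeartbeats 1000000

open Polynomial

namespace SkewConstruction

/-- the lower shift matrix `wₙ = ∑_{i=1}^{n-1} e_{i+1,i}` of size `n` (`w₁ = 0`). -/
def wmat (F : Type*) [Field F] (n : ℕ) : Matrix (Fin n) (Fin n) F :=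
  Matrix.of fun (a b : Fin n) => if (a : ℕ) = (b : ℕ) + 1 then (1 : F) else 0

/-- `F_k = f₀ f₁ ⋯ f_k`. -/
noncomputable def Fk {F : Type*} [Field F] (f : ℕ → F[X]) (k : ℕ) : F[X] :=
  ∏ m ∈ Finset.range (k + 1), f m

/-- `N(k)`, the degree of `F_k`. -/
noncomputable def Nk {F : Type*} [Field F] (f : ℕ → F[X]) (k : ℕ) : ℕ :=
  (Fk f k).natDegree

/-- for `n ≥ M 1`, the unique `k ≥ 1` with `M k ≤ n < M (k+1)`. -/
def kidx (M : ℕ → ℕ) (n : ℕ) : ℕ :=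
  Nat.findGreatest (fun k => M k ≤ n) n

/-- the matrix `wₙ*` of the construction: for `n < M(1)` it is the upper shift
`∑_{i=1}^{n-1} e_{i,i+1}`; for `M(k) ≤ n < M(k+1)` (`k ≥ 1`) one subtracts
`∑_{j=1}^{N(k)} a_{k,j} (e_{j,1} + e_{n,n-j+1})`, where `a_{k,j}` is the `j`-th
coefficient of `F_k` (written here via `Polynomial.coeff`, which vanishes beyond the
degree `N(k)`). -/
noncomputable def wstarmat {F : Type*} [Field F] (f : ℕ → F[X]) (M : ℕ → ℕ) (n : ℕ) :
    Matrix (Fin n) (Fin n) F :=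
  (Matrix.of fun (a b : Fin n) => if (b : ℕ) = (a : ℕ) + 1 then (1 : F) else 0) -
    (if M 1 ≤ n then
      (Matrix.of fun (a b : Fin n) =>
        (if (b : ℕ) = 0 then (Fk f (kidx M n)).coeff ((a : ℕ) + 1) else 0) +
        (if (a : ℕ) = n - 1 then (Fk f (kidx M n)).coeff (n - (b : ℕ)) else 0))
    else 0)

end SkewConstruction


namespace SkewConstruction

open Polynomial

/-- `T = ∏_{n=1}^∞ Mₙ(F)`; the index `n : ℕ` corresponds to the factor `M_{n+1}(F)`. -/
abbrev TProd (F : Type*) [Field F] : Type _ :=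
  ∀ n : ℕ, Matrix (Fin (n + 1)) (Fin (n + 1)) F

/-- the element `w = (wₙ)ₙ ∈ T`. -/
def wT (F : Type*) [Field F] : TProd F := fun n => wmat F (n + 1)

/-- the element `w* = (wₙ*)ₙ ∈ T`. -/
noncomputable def wstarT {F : Type*} [Field F] (f : ℕ → F[X]) (M : ℕ → ℕ) : TProd F :=
  fun n => wstarmat f M (n + 1)

/-- `soc(T) = ⊕_{n=1}^∞ Mₙ(F)`, the ideal of sequences with finitely many nonzero
components. -/
def socSet (F : Type*) [Field F] : Set (TProd F) :=
  {x | ∃ N : ℕ, ∀ n : ℕ, N ≤ n → x n = 0}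

/-- the unital `F`-subalgebra `R` of `T` generated by `soc(T)`, `w`, `w*` and the
inverses `f(w)⁻¹` of all `f(w)` with `f ∈ Σ` (these are units of `T`, and `Ring.inverse`
produces their inverses). -/
noncomputable def Ralg (F : Type*) [Field F] (f : ℕ → F[X]) (M : ℕ → ℕ) :
    Subalgebra F (TProd F) :=
  Algebra.adjoin F (socSet F ∪ {wT F, wstarT f M} ∪
    {y : TProd F | ∃ p : F[X], p.coeff 0 = 1 ∧ y = Ring.inverse (aeval (wT F) p)})

end SkewConstruction

namespace SkewConstruction

section Filtration

variable {F : Type*} [Field F] {ι : Type*}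

/-- Left multiplication by `r` eventually maps each level of `W` into some level of `W`. -/
def Preserves (W : ι → ∀ n : ℕ, Submodule F (Fin (n + 1) → F)) (r : TProd F) : Prop :=
  ∀ a, ∃ b, ∀ᶠ n in Filter.atTop, ∀ v ∈ W a n, (r n).mulVec v ∈ W b n

/-- The columns of `x` eventually lie in a fixed level of `W`. -/
def RangeIn (W : ι → ∀ n : ℕ, Submodule F (Fin (n + 1) → F)) (x : TProd F) : Prop :=
  ∃ a, ∀ᶠ n in Filter.atTop, ∀ u, (x n).mulVec u ∈ W a n

/-- Any two levels of `W` are eventually contained in a common level. -/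
def EventuallyDirected (W : ι → ∀ n : ℕ, Submodule F (Fin (n + 1) → F)) : Prop :=
  ∀ a b, ∃ c, ∀ᶠ n in Filter.atTop, W a n ≤ W c n ∧ W b n ≤ W c n

variable {W : ι → ∀ n : ℕ, Submodule F (Fin (n + 1) → F)}

lemma eventually_eq_zero_of_mem_socSet {x : TProd F} (hx : x ∈ socSet F) :
    ∀ᶠ n in Filter.atTop, x n = 0 :=
  Filter.eventually_atTop.2 hx

lemma Preserves.of_mem_socSet {r : TProd F} (hr : r ∈ socSet F) : Preserves W r := by
  intro a
  refine ⟨a, ?_⟩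
  filter_upwards [eventually_eq_zero_of_mem_socSet hr] with n hn v _
  simp [hn]

lemma Preserves.scalar (c : F) : Preserves W (algebraMap F (TProd F) c) := by
  intro a
  refine ⟨a, .of_forall fun n v hv => ?_⟩
  have h : (algebraMap F (TProd F) c) n = c • 1 := by
    simp [Algebra.algebraMap_eq_smul_one]
  rw [h, Matrix.smul_mulVec, Matrix.one_mulVec]
  exact (W a n).smul_mem c hv

lemma Preserves.add (hW : EventuallyDirected W) {r s : TProd F} (hr : Preserves W r)
    (hs : Preserves W s) : Preserves W (r + s) := by
  intro a
  obtain ⟨b, hb⟩ := hr a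
  obtain ⟨c, hc⟩ := hs a
  obtain ⟨d, hd⟩ := hW b c
  refine ⟨d, ?_⟩
  filter_upwards [hb, hc, hd] with n h1 h2 h3 v hv
  rw [Pi.add_apply, Matrix.add_mulVec]
  exact (W d n).add_mem (h3.1 (h1 v hv)) (h3.2 (h2 v hv))

lemma Preserves.mul {r s : TProd F} (hr : Preserves W r) (hs : Preserves W s) :
    Preserves W (r * s) := by
  intro a
  obtain ⟨b, hb⟩ := hs a
  obtain ⟨c, hc⟩ := hr b
  refine ⟨c, ?_⟩
  filter_upwards [hb, hc] with n h1 h2 v hv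
  rw [Pi.mul_apply, ← Matrix.mulVec_mulVec]
  exact h2 _ (h1 v hv)

lemma RangeIn.of_mem_socSet [Nonempty ι] {x : TProd F} (hx : x ∈ socSet F) : RangeIn W x := by
  refine ⟨Classical.arbitrary ι, ?_⟩
  filter_upwards [eventually_eq_zero_of_mem_socSet hx] with n hn u
  simp [hn]

lemma RangeIn.add (hW : EventuallyDirected W) {x y : TProd F} (hx : RangeIn W x)
    (hy : RangeIn W y) : RangeIn W (x + y) := by
  obtain ⟨b, hb⟩ := hx
  obtain ⟨c, hc⟩ := hy
  obtain ⟨d, hd⟩ := hW b c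
  refine ⟨d, ?_⟩
  filter_upwards [hb, hc, hd] with n h1 h2 h3 u
  rw [Pi.add_apply, Matrix.add_mulVec]
  exact (W d n).add_mem (h3.1 (h1 u)) (h3.2 (h2 u))

lemma RangeIn.neg {x : TProd F} (hx : RangeIn W x) : RangeIn W (-x) := by
  obtain ⟨b, hb⟩ := hx
  refine ⟨b, ?_⟩
  filter_upwards [hb] with n h1 u
  rw [Pi.neg_apply, Matrix.neg_mulVec]
  exact (W b n).neg_mem (h1 u)

lemma RangeIn.mul_right {x : TProd F} (hx : RangeIn W x) (y : TProd F) : RangeIn W (x * y) := by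
  obtain ⟨b, hb⟩ := hx
  refine ⟨b, ?_⟩
  filter_upwards [hb] with n h1 u
  rw [Pi.mul_apply, ← Matrix.mulVec_mulVec]
  exact h1 _

lemma RangeIn.mul_left {r x : TProd F} (hr : Preserves W r) (hx : RangeIn W x) :
    RangeIn W (r * x) := by
  obtain ⟨b, hb⟩ := hx
  obtain ⟨c, hc⟩ := hr b
  refine ⟨c, ?_⟩
  filter_upwards [hb, hc] with n h1 h2 u
  rw [Pi.mul_apply, ← Matrix.mulVec_mulVec]
  exact h2 _ (h1 u)

/-- If the generators of `R` preserve `W`, then every element of `R` does. -/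
lemma Preserves.of_mem_Ralg {f : ℕ → F[X]} {M : ℕ → ℕ} (hW : EventuallyDirected W)
    (hw : Preserves W (wT F)) (hws : Preserves W (wstarT f M))
    (hinv : ∀ p : F[X], p.coeff 0 = 1 → Preserves W (Ring.inverse (aeval (wT F) p)))
    {r : TProd F} (hr : r ∈ Ralg F f M) : Preserves W r := by
  induction hr using Algebra.adjoin_induction with
  | mem x hx =>
    rcases hx with (hx | rfl | rfl) | ⟨p, hp, rfl⟩
    · exact .of_mem_socSet hx
    · exact hw
    · exact hws
    · exact hinv p hp
  | algebraMap c => exact .scalar c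
  | add x y _ _ hx hy => exact hx.add hW hy
  | mul x y _ _ hx hy => exact hx.mul hy

lemma RangeIn.of_mem_span [Nonempty ι] {f : ℕ → F[X]} {M : ℕ → ℕ} (hW : EventuallyDirected W)
    (hR : ∀ r ∈ Ralg F f M, Preserves W r) {e : TProd F} (he : RangeIn W e) {x : Ralg F f M}
    (hx : x ∈ TwoSidedIdeal.span
      {x : Ralg F f M | (x : TProd F) = e ∨ (x : TProd F) ∈ socSet F}) :
    RangeIn W (x : TProd F) := by
  let I : TwoSidedIdeal (Ralg F f M) := TwoSidedIdeal.mk' {x | RangeIn W (x : TProd F)}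
    (.of_mem_socSet ⟨0, fun _ _ => rfl⟩) (fun h h' => h.add hW h') (fun h => h.neg)
    (fun {r _} h => h.mul_left (hR r r.2)) (fun {_ y} h => h.mul_right y)
  have hI : ∀ y, y ∈ I ↔ RangeIn W (y : TProd F) := fun y => by
    simp only [I, TwoSidedIdeal.mem_mk', Set.mem_ofPred_eq]
  rw [← hI]
  refine TwoSidedIdeal.span_le.2 ?_ hx
  rintro y (hy | hy)
  · exact (hI y).2 (hy ▸ he)
  · exact (hI y).2 (.of_mem_socSet hy)

end Filtration

section CoeffVec

variable {F : Type*} [Field F]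

/-- The first `n + 1` coefficients of a polynomial. -/
noncomputable def coeffVec (F : Type*) [Field F] (n : ℕ) : F[X] →ₗ[F] (Fin (n + 1) → F) :=
  LinearMap.pi fun i => Polynomial.lcoeff F i

@[simp]
lemma coeffVec_apply (n : ℕ) (V : F[X]) (i : Fin (n + 1)) : coeffVec F n V i = V.coeff i := rfl

lemma coeffVec_surjective (n : ℕ) : Function.Surjective (coeffVec F n) := by
  intro v
  refine ⟨∑ i : Fin (n + 1), Polynomial.monomial i (v i), funext fun j => ?_⟩
  simp [Polynomial.coeff_monomial, Fin.val_inj]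

lemma wmat_mulVec_coeffVec (n : ℕ) (V : F[X]) :
    (wmat F (n + 1)).mulVec (coeffVec F n V) = coeffVec F n (X * V) := by
  funext i
  simp only [wmat, Matrix.mulVec, dotProduct, Matrix.of_apply, coeffVec_apply, ite_mul, one_mul,
    zero_mul]
  rcases i with ⟨_ | i, hi⟩
  · simp
  · rw [Finset.sum_eq_single (⟨i, by omega⟩ : Fin (n + 1))]
    · simp
    · rintro ⟨b, hb⟩ _ h
      rw [if_neg]
      simpa [eq_comm] using h
    · simp

lemma aeval_wmat_mulVec_coeffVec (n : ℕ) (p V : F[X]) :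
    (aeval (wmat F (n + 1)) p).mulVec (coeffVec F n V) = coeffVec F n (p * V) := by
  induction p using Polynomial.induction_on' generalizing V with
  | add p q hp hq => simp [Matrix.add_mulVec, hp, hq, add_mul]
  | monomial m a =>
    induction m generalizing V with
    | zero =>
      simp [Algebra.algebraMap_eq_smul_one, Matrix.smul_mulVec, ← Polynomial.smul_eq_C_mul]
    | succ m ih =>
      rw [← Polynomial.monomial_mul_X, map_mul, ← Matrix.mulVec_mulVec, Polynomial.aeval_X,
        wmat_mulVec_coeffVec, ih, mul_assoc]

lemma aeval_wmat_X_pow (n : ℕ) : aeval (wmat F (n + 1)) (X ^ (n + 1) : F[X]) = 0 := by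
  refine Matrix.mulVec_injective (funext fun v => ?_)
  obtain ⟨V, rfl⟩ := coeffVec_surjective n v
  rw [aeval_wmat_mulVec_coeffVec, Matrix.zero_mulVec]
  funext i
  rw [coeffVec_apply, Polynomial.coeff_X_pow_mul', if_neg (by omega), Pi.zero_apply]

lemma exists_aeval_wmat_mul_eq_one (n : ℕ) {p : F[X]} (hp : p.coeff 0 = 1) :
    ∃ q : F[X], aeval (wmat F (n + 1)) q * aeval (wmat F (n + 1)) p = 1 := by
  have h : IsCoprime (X ^ (n + 1)) p := by
    refine IsCoprime.pow_left ⟨-p.divX, 1, ?_⟩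
    have := Polynomial.divX_mul_X_add p
    rw [hp, map_one] at this
    linear_combination -this
  obtain ⟨a, q, hq⟩ := h
  refine ⟨q, ?_⟩
  have := congrArg (aeval (wmat F (n + 1))) hq
  rwa [map_add, map_mul _ a, aeval_wmat_X_pow, mul_zero, zero_add, map_mul, map_one] at this

lemma aeval_wT_apply (p : F[X]) (n : ℕ) : (aeval (wT F) p) n = aeval (wmat F (n + 1)) p :=
  (Polynomial.aeval_algHom_apply (Pi.evalAlgHom F _ n) (wT F) p).symm

lemma exists_inverse_apply (n : ℕ) {p : F[X]} (hp : p.coeff 0 = 1) :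
    ∃ q : F[X], (Ring.inverse (aeval (wT F) p)) n = aeval (wmat F (n + 1)) q ∧
      aeval (wmat F (n + 1)) q * aeval (wmat F (n + 1)) p = 1 := by
  choose q hq using fun n => exists_aeval_wmat_mul_eq_one (F := F) n hp
  let y : TProd F := fun n => aeval (wmat F (n + 1)) (q n)
  have h1 : y * aeval (wT F) p = 1 := funext fun n => by
    rw [Pi.mul_apply, aeval_wT_apply]; exact hq n
  have h2 : aeval (wT F) p * y = 1 := funext fun n => by
    rw [Pi.mul_apply, aeval_wT_apply]
    exact mul_eq_one_comm.1 (hq n)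
  refine ⟨q n, ?_, hq n⟩
  have h3 : Ring.inverse (aeval (wT F) p) = y := Ring.inverse_unit ⟨_, y, h2, h1⟩
  rw [h3]

end CoeffVec

section WStar

variable {F : Type*} [Field F] {f : ℕ → F[X]} {M : ℕ → ℕ} {n : ℕ}

lemma wstarmat_mulVec_of_lt (hn : M 1 ≤ n + 1) (v : Fin (n + 1) → F) (i : ℕ) (hi : i < n) :
    (wstarmat f M (n + 1)).mulVec v ⟨i, by omega⟩ =
      v ⟨i + 1, by omega⟩ - (Fk f (kidx M (n + 1))).coeff (i + 1) * v 0 := by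
  have h1 : ∀ b : Fin (n + 1), (b : ℕ) = i + 1 ↔ b = ⟨i + 1, by omega⟩ := fun b => by
    rw [Fin.ext_iff]
  have h2 : ∀ b : Fin (n + 1), (b : ℕ) = 0 ↔ b = 0 := fun b => by
    rw [Fin.ext_iff]; rfl
  simp only [wstarmat, if_pos hn, Matrix.mulVec, dotProduct, Matrix.sub_apply, sub_mul,
    Finset.sum_sub_distrib, Matrix.of_apply, h1, h2, Nat.add_sub_cancel, if_neg hi.ne, add_zero,
    ite_mul, one_mul, zero_mul, Finset.sum_ite_eq', Finset.mem_univ, if_true]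

lemma wstarmat_mulVec_last (hn : M 1 ≤ n + 1) (v : Fin (n + 1) → F) :
    (wstarmat f M (n + 1)).mulVec v (Fin.last n) =
      -((Fk f (kidx M (n + 1))).coeff (n + 1) * v 0 +
        ∑ b : Fin (n + 1), (Fk f (kidx M (n + 1))).coeff (n + 1 - b) * v b) := by
  have h1 : ∀ b : Fin (n + 1), ¬ (b : ℕ) = n + 1 := fun b => by omega
  have h2 : ∀ b : Fin (n + 1), (b : ℕ) = 0 ↔ b = 0 := fun b => by
    rw [Fin.ext_iff]; rfl
  simp only [wstarmat, if_pos hn, Matrix.mulVec, dotProduct, Matrix.sub_apply,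
    Matrix.of_apply, Fin.val_last, if_neg (h1 _), h2, Nat.add_sub_cancel, if_true, zero_sub,
    neg_mul, add_mul, ite_mul, zero_mul, Finset.sum_neg_distrib, Finset.sum_add_distrib,
    Finset.sum_ite_eq', Finset.mem_univ]

lemma wmat_mulVec_zero (v : Fin (n + 1) → F) : (wmat F (n + 1)).mulVec v 0 = 0 := by
  obtain ⟨V, rfl⟩ := coeffVec_surjective n v
  rw [wmat_mulVec_coeffVec]
  simp

lemma wmat_mulVec_succ (v : Fin (n + 1) → F) (i : ℕ) (hi : i < n) :
    (wmat F (n + 1)).mulVec v ⟨i + 1, by omega⟩ = v ⟨i, by omega⟩ := by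
  obtain ⟨V, rfl⟩ := coeffVec_surjective n v
  rw [wmat_mulVec_coeffVec]
  simp

lemma Fk_coeff_zero (hfmem : ∀ m : ℕ, (f m).coeff 0 = 1) (k : ℕ) : (Fk f k).coeff 0 = 1 := by
  simp [Fk, Polynomial.coeff_zero_eq_eval_zero, Polynomial.eval_prod] at hfmem ⊢
  simp [hfmem]

lemma le_kidx (hM : StrictMono M) {m : ℕ} (h : M m ≤ n) : m ≤ kidx M n :=
  Nat.le_findGreatest ((hM.id_le m).trans h) h

lemma kidx_spec (hM : StrictMono M) (h : M 1 ≤ n) : M (kidx M n) ≤ n :=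
  Nat.findGreatest_spec (P := fun k => M k ≤ n) ((hM.id_le 1).trans h) h

lemma eventually_two_mul_Nk_add_lt (hM : StrictMono M)
    (hMN : ∀ k : ℕ, 1 ≤ k → 2 * (k + 1) * Nk f k ≤ M k) (c : ℕ) :
    ∀ᶠ n in Filter.atTop, 2 * Nk f (kidx M (n + 1)) + c < n + 1 := by
  filter_upwards [Filter.eventually_ge_atTop (M 1 + 2 * c)] with n hn
  have h1 : M 1 ≤ n + 1 := by omega
  have h2 := le_kidx hM h1
  have h3 := hMN _ h2
  have h4 := kidx_spec hM h1
  have h5 : 4 * Nk f (kidx M (n + 1)) ≤ 2 * (kidx M (n + 1) + 1) * Nk f (kidx M (n + 1)) :=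
    Nat.mul_le_mul_right _ (by omega)
  omega

lemma eventually_dvd_Fk (hM : StrictMono M)
    (hfenum : ∀ p : F[X], p.coeff 0 = 1 → ∃ m : ℕ, f m = p) {p : F[X]} (hp : p.coeff 0 = 1) :
    ∀ᶠ n in Filter.atTop, p ∣ Fk f (kidx M (n + 1)) := by
  obtain ⟨m, rfl⟩ := hfenum p hp
  filter_upwards [Filter.eventually_ge_atTop (M m)] with n hn
  have := le_kidx hM (show M m ≤ n + 1 by omega)
  exact Finset.dvd_prod_of_mem f (Finset.mem_range.2 (by omega))

end WStar

section Bottom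

variable {F : Type*} [Field F]

/-- The vectors supported on the last `c` coordinates. -/
def bottom (F : Type*) [Field F] (c n : ℕ) : Submodule F (Fin (n + 1) → F) where
  carrier := {v | ∀ i : Fin (n + 1), (i : ℕ) + c < n + 1 → v i = 0}
  add_mem' h h' i hi := by simp [h i hi, h' i hi]
  zero_mem' _ _ := rfl
  smul_mem' a v h i hi := by simp [h i hi]

lemma eventuallyDirected_bottom : EventuallyDirected (bottom F) := by
  intro a b
  refine ⟨max a b, .of_forall fun n => ⟨fun v hv i hi => hv i ?_, fun v hv i hi => hv i ?_⟩⟩ <;>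
    omega

lemma aeval_wmat_mulVec_mem_bottom {c n : ℕ} (q : F[X]) {v : Fin (n + 1) → F}
    (hv : v ∈ bottom F c n) : (aeval (wmat F (n + 1)) q).mulVec v ∈ bottom F c n := by
  obtain ⟨V, rfl⟩ := coeffVec_surjective n v
  rw [aeval_wmat_mulVec_coeffVec]
  intro i hi
  rw [coeffVec_apply, Polynomial.coeff_mul]
  refine Finset.sum_eq_zero fun x hx => ?_
  have hx' := Finset.HasAntidiagonal.mem_antidiagonal.1 hx
  have := hv ⟨x.2, by omega⟩ (by simp only; omega)
  rw [coeffVec_apply] at this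
  simp only at this
  rw [this, mul_zero]

variable {f : ℕ → F[X]} {M : ℕ → ℕ}

lemma preserves_bottom {r : TProd F} (hr : r ∈ Ralg F f M) : Preserves (bottom F) r := by
  refine Preserves.of_mem_Ralg eventuallyDirected_bottom ?_ ?_ ?_ hr
  · intro c
    refine ⟨c, .of_forall fun n v hv => ?_⟩
    have := aeval_wmat_mulVec_mem_bottom X hv
    rwa [Polynomial.aeval_X] at this
  · intro c
    refine ⟨c + 1, ?_⟩
    filter_upwards [Filter.eventually_ge_atTop (M 1 + c)] with n hn v hv ⟨i, hi⟩ hic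
    simp only at hic
    change (wstarmat f M (n + 1)).mulVec v _ = 0
    rw [wstarmat_mulVec_of_lt (by omega) v i (by omega), hv _ (by simp only; omega),
      hv 0 (by simp; omega)]
    simp
  · intro p hp c
    refine ⟨c, .of_forall fun n v hv => ?_⟩
    obtain ⟨q, hq, -⟩ := exists_inverse_apply n hp
    rw [hq]
    exact aeval_wmat_mulVec_mem_bottom q hv

lemma rangeIn_bottom : RangeIn (bottom F) (1 - wstarT f M * wT F) := by
  refine ⟨1, ?_⟩
  filter_upwards [Filter.eventually_ge_atTop (M 1)] with n hn u ⟨i, hi⟩ hic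
  simp only at hic
  change ((1 - wstarmat f M (n + 1) * wmat F (n + 1)).mulVec u) _ = 0
  rw [Matrix.sub_mulVec, Matrix.one_mulVec, ← Matrix.mulVec_mulVec, Pi.sub_apply,
    wstarmat_mulVec_of_lt (by omega) _ i (by omega), wmat_mulVec_succ _ i (by omega),
    wmat_mulVec_zero]
  simp

end Bottom

section Top

variable {F : Type*} [Field F]

/-- The coefficient vectors of the polynomials `V` with `p V = F_k g` and `deg g ≤ d`. -/
noncomputable def top (f : ℕ → F[X]) (M : ℕ → ℕ) (a : {p : F[X] // p.coeff 0 = 1} × ℕ) (n : ℕ) :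
    Submodule F (Fin (n + 1) → F) :=
  Submodule.map (coeffVec F n)
    { carrier := {V | ∃ g : F[X], g.natDegree ≤ a.2 ∧ a.1 * V = Fk f (kidx M (n + 1)) * g}
      add_mem' := by
        rintro V V' ⟨g, hg, h⟩ ⟨g', hg', h'⟩
        exact ⟨g + g', Polynomial.natDegree_add_le_of_degree_le hg hg', by
          rw [mul_add, mul_add, h, h']⟩
      zero_mem' := ⟨0, by simp, by simp⟩
      smul_mem' := by
        rintro c V ⟨g, hg, h⟩
        exact ⟨c • g, (Polynomial.natDegree_smul_le c g).trans hg, by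
          rw [mul_smul_comm, mul_smul_comm, h]⟩ }

variable {f : ℕ → F[X]} {M : ℕ → ℕ}

lemma mem_top {a : {p : F[X] // p.coeff 0 = 1} × ℕ} {n : ℕ} {v : Fin (n + 1) → F} :
    v ∈ top f M a n ↔ ∃ V g : F[X], g.natDegree ≤ a.2 ∧
      a.1 * V = Fk f (kidx M (n + 1)) * g ∧ coeffVec F n V = v := by
  constructor
  · rintro ⟨V, ⟨g, hg, h⟩, hV⟩
    exact ⟨V, g, hg, h, hV⟩
  · rintro ⟨V, g, hg, h, hV⟩
    exact ⟨V, ⟨g, hg, h⟩, hV⟩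

instance : Nonempty ({p : F[X] // p.coeff 0 = 1} × ℕ) := ⟨(⟨1, by simp⟩, 0)⟩

lemma natDegree_le_of_mul_eq {p V g : F[X]} (hp : p.coeff 0 = 1) {k d : ℕ}
    (hg : g.natDegree ≤ d) (h : p * V = Fk f k * g) : V.natDegree ≤ Nk f k + d := by
  have hp0 : p ≠ 0 := by rintro rfl; simp at hp
  rcases eq_or_ne V 0 with rfl | hV
  · simp
  have h1 := congrArg Polynomial.natDegree h
  rw [Polynomial.natDegree_mul hp0 hV] at h1
  have h2 := Polynomial.natDegree_mul_le (p := Fk f k) (q := g)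
  unfold Nk
  omega

lemma eventuallyDirected_top : EventuallyDirected (top f M) := by
  rintro ⟨⟨p, hp⟩, d⟩ ⟨⟨q, hq⟩, e⟩
  refine ⟨(⟨p * q, by simp [Polynomial.mul_coeff_zero, hp, hq]⟩,
    d + e + p.natDegree + q.natDegree), .of_forall fun n => ⟨fun v hv => ?_, fun v hv => ?_⟩⟩ <;>
  obtain ⟨V, g, hg, h, rfl⟩ := mem_top.1 hv <;> simp only at hg h
  · refine mem_top.2 ⟨V, q * g, ?_, by linear_combination q * h, rfl⟩
    have := Polynomial.natDegree_mul_le (p := q) (q := g)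
    simp only
    omega
  · refine mem_top.2 ⟨V, p * g, ?_, by linear_combination p * h, rfl⟩
    have := Polynomial.natDegree_mul_le (p := p) (q := g)
    simp only
    omega

lemma preserves_top_wstarT (hfmem : ∀ m : ℕ, (f m).coeff 0 = 1) (hM : StrictMono M)
    (hMN : ∀ k : ℕ, 1 ≤ k → 2 * (k + 1) * Nk f k ≤ M k) :
    Preserves (top f M) (wstarT f M) := by
  rintro ⟨⟨p, hp⟩, d⟩
  refine ⟨(⟨p, hp⟩, max d p.natDegree), ?_⟩
  filter_upwards [eventually_two_mul_Nk_add_lt hM hMN d,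
    Filter.eventually_ge_atTop (M 1)] with n hn hn1 v hv
  obtain ⟨V, g, hg, h, rfl⟩ := mem_top.1 hv
  simp only at hg h
  have hdeg := natDegree_le_of_mul_eq hp hg h
  have hF0 := Fk_coeff_zero hfmem (kidx M (n + 1))
  have hFdeg : (Fk f (kidx M (n + 1))).natDegree = Nk f (kidx M (n + 1)) := rfl
  have hV0 : V.coeff 0 = g.coeff 0 := by
    have := congrArg (fun q => Polynomial.coeff q 0) h
    simpa [Polynomial.mul_coeff_zero, hp, hF0] using this
  have hX : ∀ q : F[X], q.coeff 0 = 0 → q.divX * X = q := fun q hq => by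
    simpa [hq] using Polynomial.divX_mul_X_add q
  refine mem_top.2 ⟨(V - Polynomial.C (V.coeff 0) * Fk f (kidx M (n + 1))).divX,
    (g - Polynomial.C (g.coeff 0) * p).divX, ?_, ?_, ?_⟩
  · have h1 := Polynomial.natDegree_sub_le g (Polynomial.C (g.coeff 0) * p)
    have h2 := Polynomial.natDegree_C_mul_le (g.coeff 0) p
    rw [Polynomial.natDegree_divX_eq_natDegree_tsub_one]
    simp only
    omega
  · refine mul_right_cancel₀ (Polynomial.X_ne_zero (R := F)) ?_
    rw [mul_assoc, mul_assoc, hX _ (by simp [Polynomial.mul_coeff_zero, hF0]),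
      hX _ (by simp [Polynomial.mul_coeff_zero, hp]), hV0]
    linear_combination h
  · funext ⟨i, hi⟩
    change _ = (wstarmat f M (n + 1)).mulVec _ _
    rcases Nat.lt_succ_iff_lt_or_eq.1 hi with hi' | rfl
    · rw [wstarmat_mulVec_of_lt (by omega) _ i hi']
      simp [Polynomial.coeff_divX, mul_comm]
    · have h1 : (Fk f (kidx M (i + 1))).coeff (i + 1) = 0 :=
        Polynomial.coeff_eq_zero_of_natDegree_lt (by omega)
      have h2 : V.coeff (i + 1) = 0 := Polynomial.coeff_eq_zero_of_natDegree_lt (by omega)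
      have h3 := wstarmat_mulVec_last (f := f) (M := M) (n := i) (by omega) (coeffVec F i V)
      refine Eq.trans ?_ h3.symm
      rw [Finset.sum_eq_zero, h1]
      · simp [Polynomial.coeff_divX, h1, h2]
      · rintro ⟨b, hb⟩ -
        rcases lt_or_ge (Nk f (kidx M (i + 1))) (i + 1 - b) with hlt | hge
        · rw [Polynomial.coeff_eq_zero_of_natDegree_lt (by simp only; omega), zero_mul]
        · rw [coeffVec_apply, Polynomial.coeff_eq_zero_of_natDegree_lt (p := V)
            (by simp only; omega), mul_zero]

lemma preserves_top_wT : Preserves (top f M) (wT F) := by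
  rintro ⟨p, d⟩
  refine ⟨(p, d + 1), .of_forall fun n v hv => ?_⟩
  obtain ⟨V, g, hg, h, rfl⟩ := mem_top.1 hv
  simp only at hg h
  refine mem_top.2 ⟨X * V, X * g, ?_, by linear_combination X * h,
    (wmat_mulVec_coeffVec n V).symm⟩
  have := Polynomial.natDegree_mul_le (p := X) (q := g)
  have := Polynomial.natDegree_X_le (R := F)
  simp only
  omega

lemma preserves_top_inverse (hM : StrictMono M)
    (hfenum : ∀ p : F[X], p.coeff 0 = 1 → ∃ m : ℕ, f m = p) {q : F[X]} (hq : q.coeff 0 = 1) :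
    Preserves (top f M) (Ring.inverse (aeval (wT F) q)) := by
  rintro ⟨⟨p, hp⟩, d⟩
  have hpq : (p * q).coeff 0 = 1 := by simp [Polynomial.mul_coeff_zero, hp, hq]
  refine ⟨(⟨p * q, hpq⟩, d), ?_⟩
  filter_upwards [eventually_dvd_Fk hM hfenum hpq] with n ⟨H, hH⟩ v hv
  obtain ⟨V, g, hg, h, rfl⟩ := mem_top.1 hv
  simp only at hg h
  have hp0 : p ≠ 0 := by rintro rfl; simp at hp
  have hV : V = q * (H * g) := mul_left_cancel₀ hp0 (by rw [h, hH]; ring)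
  refine mem_top.2 ⟨H * g, g, hg, by simp only; rw [hH]; ring, ?_⟩
  obtain ⟨q', hq', h1⟩ := exists_inverse_apply n hq
  rw [hq', hV, ← aeval_wmat_mulVec_coeffVec n q, Matrix.mulVec_mulVec, h1, Matrix.one_mulVec]

lemma preserves_top (hfmem : ∀ m : ℕ, (f m).coeff 0 = 1)
    (hfenum : ∀ p : F[X], p.coeff 0 = 1 → ∃ m : ℕ, f m = p) (hM : StrictMono M)
    (hMN : ∀ k : ℕ, 1 ≤ k → 2 * (k + 1) * Nk f k ≤ M k) {r : TProd F} (hr : r ∈ Ralg F f M) :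
    Preserves (top f M) r :=
  Preserves.of_mem_Ralg eventuallyDirected_top preserves_top_wT
    (preserves_top_wstarT hfmem hM hMN) (fun _ hp => preserves_top_inverse hM hfenum hp) hr

lemma rangeIn_top (hfmem : ∀ m : ℕ, (f m).coeff 0 = 1) :
    RangeIn (top f M) (1 - wT F * wstarT f M) := by
  refine ⟨(⟨1, by simp⟩, 0), ?_⟩
  filter_upwards [Filter.eventually_ge_atTop (M 1)] with n hn u
  refine mem_top.2 ⟨Polynomial.C (u 0) * Fk f (kidx M (n + 1)), Polynomial.C (u 0), by simp,
    by simp only; ring, ?_⟩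
  change _ = (1 - wmat F (n + 1) * wstarmat f M (n + 1)).mulVec u
  rw [Matrix.sub_mulVec, Matrix.one_mulVec, ← Matrix.mulVec_mulVec]
  funext ⟨i, hi⟩
  rw [Pi.sub_apply]
  rcases i with _ | i
  · refine Eq.trans ?_ (congrArg (u 0 - ·) (wmat_mulVec_zero _).symm)
    simp [Polynomial.mul_coeff_zero, Fk_coeff_zero hfmem]
  · rw [wmat_mulVec_succ _ i (by omega), wstarmat_mulVec_of_lt (by omega) _ i (by omega)]
    simp [mul_comm]

lemma eventually_top_inf_bottom_eq_bot (hM : StrictMono M)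
    (hMN : ∀ k : ℕ, 1 ≤ k → 2 * (k + 1) * Nk f k ≤ M k)
    (a : {p : F[X] // p.coeff 0 = 1} × ℕ) (c : ℕ) :
    ∀ᶠ n in Filter.atTop, ∀ v, v ∈ top f M a n → v ∈ bottom F c n → v = 0 := by
  filter_upwards [eventually_two_mul_Nk_add_lt hM hMN (a.2 + c)] with n hn v hv hv'
  obtain ⟨V, g, hg, h, rfl⟩ := mem_top.1 hv
  have hdeg := natDegree_le_of_mul_eq a.1.2 hg h
  funext i
  rcases lt_or_ge (i + c) (n + 1) with hi | hi
  · exact hv' i hi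
  · exact Polynomial.coeff_eq_zero_of_natDegree_lt (by omega)

lemma mem_socSet_of_rangeIn (hM : StrictMono M)
    (hMN : ∀ k : ℕ, 1 ≤ k → 2 * (k + 1) * Nk f k ≤ M k) {x : TProd F}
    (h : RangeIn (top f M) x) (h' : RangeIn (bottom F) x) : x ∈ socSet F := by
  obtain ⟨a, ha⟩ := h
  obtain ⟨c, hc⟩ := h'
  refine Filter.eventually_atTop.1 ?_
  filter_upwards [ha, hc, eventually_top_inf_bottom_eq_bot hM hMN a c] with n h1 h2 h3
  refine Matrix.mulVec_injective (funext fun u => ?_)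
  rw [h3 _ (h1 u) (h2 u), Matrix.zero_mulVec]

end Top

end SkewConstruction

open SkewConstruction in
/-- Proposition 5.4 of the paper: with `M₁` the two-sided ideal of `R` generated by
`1 − w w*` together with `soc(T)`, and `M₂` the two-sided ideal generated by `1 − w* w`
together with `soc(T)`, one has `M₁ M₂ = M₁ ∩ M₂ = soc(T)`. -/
theorem stmt7 {F : Type*} [Field F] [Countable F]
    (f : ℕ → F[X]) (hf0 : f 0 = 1)
    (hfmem : ∀ m : ℕ, (f m).coeff 0 = 1)
    (hfenum : ∀ p : F[X], p.coeff 0 = 1 → ∃ m : ℕ, f m = p)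
    (M : ℕ → ℕ) (hM : StrictMono M) (hM1 : 1 ≤ M 1)
    (hMN : ∀ k : ℕ, 1 ≤ k → 2 * (k + 1) * Nk f k ≤ M k)
    (M₁ M₂ : TwoSidedIdeal (Ralg F f M))
    (hM₁ : M₁ = TwoSidedIdeal.span
      {x : Ralg F f M | (x : TProd F) = 1 - wT F * wstarT f M ∨ (x : TProd F) ∈ socSet F})
    (hM₂ : M₂ = TwoSidedIdeal.span
      {x : Ralg F f M | (x : TProd F) = 1 - wstarT f M * wT F ∨ (x : TProd F) ∈ socSet F}) :
    (AddSubmonoid.closure {z : Ralg F f M | ∃ x ∈ M₁, ∃ y ∈ M₂, z = x * y} : Set (Ralg F f M)) =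
      {z : Ralg F f M | (z : TProd F) ∈ socSet F} ∧
    (M₁ : Set (Ralg F f M)) ∩ (M₂ : Set (Ralg F f M)) =
      {z : Ralg F f M | (z : TProd F) ∈ socSet F} := by
  have hsoc₁ : ∀ z : Ralg F f M, (z : TProd F) ∈ socSet F → z ∈ M₁ := fun z hz =>
    hM₁ ▸ TwoSidedIdeal.subset_span (Or.inr hz)
  have hsoc₂ : ∀ z : Ralg F f M, (z : TProd F) ∈ socSet F → z ∈ M₂ := fun z hz =>
    hM₂ ▸ TwoSidedIdeal.subset_span (Or.inr hz)
  have hinter : ∀ z : Ralg F f M, z ∈ M₁ → z ∈ M₂ → (z : TProd F) ∈ socSet F := by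
    intro z h₁ h₂
    subst hM₁ hM₂
    exact mem_socSet_of_rangeIn hM hMN
      (RangeIn.of_mem_span eventuallyDirected_top
        (fun r hr => preserves_top hfmem hfenum hM hMN hr) (rangeIn_top hfmem) h₁)
      (RangeIn.of_mem_span eventuallyDirected_bottom
        (fun r hr => preserves_bottom hr) rangeIn_bottom h₂)
  refine ⟨Set.Subset.antisymm (fun z hz => ?_) (fun z hz => ?_),
    Set.Subset.antisymm (fun z hz => hinter z hz.1 hz.2) (fun z hz => ⟨hsoc₁ z hz, hsoc₂ z hz⟩)⟩
  · have hmem : z ∈ M₁ ∧ z ∈ M₂ := by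
      induction hz using AddSubmonoid.closure_induction with
      | mem z hz =>
        obtain ⟨x, hx, y, hy, rfl⟩ := hz
        exact ⟨M₁.mul_mem_right _ _ hx, M₂.mul_mem_left _ _ hy⟩
      | zero => exact ⟨M₁.zero_mem, M₂.zero_mem⟩
      | add x y _ _ hx hy => exact ⟨M₁.add_mem hx.1 hy.1, M₂.add_mem hx.2 hy.2⟩
    exact hinter z hmem.1 hmem.2
  · obtain ⟨N, hN⟩ := id hz
    let e : TProd F := fun n => if n < N then 1 else 0
    have he : e ∈ socSet F := ⟨N, fun n hn => if_neg (by omega)⟩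
    refine AddSubmonoid.subset_closure ⟨z, hsoc₁ z hz,
      ⟨e, Algebra.subset_adjoin (Or.inl (Or.inl he))⟩, hsoc₂ _ he, Subtype.ext (funext fun n => ?_)⟩
    change (z : TProd F) n = (z : TProd F) n * if n < N then 1 else 0
    split_ifs with h
    · rw [mul_one]
    · rw [mul_zero, hN n (by omega)]
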